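/- Nonterminating analogue of Saalschütz' summation formula: let a, b, c, e ∈ ℂ with Re(e − a − b) > 0 and with e, e−a−b, a+c−e+1, b+c−e+1, a+b+c−e+1, c+1, c−e+2 not nonpositive integers. Then [Γ(a+c−e+1) Γ(b+c−e+1) / (Γ(c−e+1) Γ(a+b+c−e+1))] · ∑_{k=0}^∞ (a)_k (b)_k (c)_k / ((e)_k (a+b+c−e+1)_k · k!) + [Γ(e) Γ(a+c−e+1) Γ(b+c−e+1) / (Γ(a) Γ(b) Γ(c+1) Γ(c−e+2))] · ∑_{k=0}^∞ (a+c−e+1)_k (b+c−e+1)_k (1)_k / ((c+1)_k (c−e+2)_k · k!) = Γ(e) Γ(e−a−b) / (Γ(e−a) Γ(e−b)), where both series converge absolutely. -/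

import Mathlib

open Complex

/-- Pochhammer symbol `(a)_k = a (a+1) ⋯ (a+k-1)`. -/
noncomputable def poch (a : ℂ) (k : ℕ) : ℂ := ∏ i ∈ Finset.range k, (a + i)

open Filter Topology

lemma poch_zero (z : ℂ) : poch z 0 = 1 := by simp [poch]

lemma poch_succ (z : ℂ) (k : ℕ) : poch z (k + 1) = poch z k * (z + k) :=
  Finset.prod_range_succ _ _

lemma poch_succ_left (z : ℂ) (k : ℕ) : poch z (k + 1) = z * poch (z + 1) k := by
  rw [poch, Finset.prod_range_succ', poch, mul_comm, Nat.cast_zero, add_zero]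
  congr 1
  exact Finset.prod_congr rfl fun i _ => by push_cast; ring

lemma poch_add (z : ℂ) (n k : ℕ) : poch z (n + k) = poch z n * poch (z + n) k := by
  simp [poch, Finset.prod_range_add, add_assoc]

lemma poch_one (k : ℕ) : poch 1 k = (k.factorial : ℂ) := by
  induction k with
  | zero => simp [poch_zero]
  | succ k ih => rw [poch_succ, ih, Nat.factorial_succ]; push_cast; ring

lemma add_natCast_ne_neg_natCast {z : ℂ} (hz : ∀ m : ℕ, z ≠ -(m : ℂ)) (n m : ℕ) :
    z + n ≠ -(m : ℂ) := fun h =>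
  hz (n + m) (by push_cast; linear_combination h)

lemma add_natCast_ne_zero {z : ℂ} (hz : ∀ m : ℕ, z ≠ -(m : ℂ)) (n : ℕ) : z + n ≠ 0 := by
  simpa using add_natCast_ne_neg_natCast hz n 0

lemma one_ne_neg_natCast (m : ℕ) : (1 : ℂ) ≠ -(m : ℂ) := fun h =>
  Nat.cast_add_one_ne_zero (R := ℂ) m (by linear_combination h)

lemma poch_ne_zero {z : ℂ} (hz : ∀ m : ℕ, z ≠ -(m : ℂ)) (k : ℕ) : poch z k ≠ 0 :=
  Finset.prod_ne_zero_iff.mpr fun i _ => add_natCast_ne_zero hz i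

lemma Gamma_add_natCast {z : ℂ} (hz : ∀ m : ℕ, z ≠ -(m : ℂ)) (n : ℕ) :
    Gamma (z + n) = Gamma z * poch z n := by
  induction n with
  | zero => simp [poch_zero]
  | succ n ih =>
    rw [poch_succ, ← mul_assoc, ← ih, Nat.cast_succ, ← add_assoc,
      Gamma_add_one _ (add_natCast_ne_zero hz n), mul_comm]

lemma tendsto_add_natCast_div_add_natCast (u v : ℂ) :
    Tendsto (fun n : ℕ => (u + n) / (v + n)) atTop (𝓝 1) := by
  simpa using tendsto_add_mul_div_add_mul_atTop_nhds u v (1 : ℂ) one_ne_zero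

lemma tendsto_inv_GammaSeq (z : ℂ) :
    Tendsto (fun n => (GammaSeq z n)⁻¹) atTop (𝓝 (Gamma z)⁻¹) := by
  by_cases hz : ∃ m : ℕ, z = -(m : ℂ)
  · obtain ⟨m, rfl⟩ := hz
    rw [Gamma_neg_nat_eq_zero, inv_zero]
    refine tendsto_const_nhds.congr' ?_
    filter_upwards [eventually_ge_atTop m] with n hn
    rw [GammaSeq, Finset.prod_eq_zero (i := m) (by simp; omega) (by simp)]
    simp
  · push Not at hz
    exact (GammaSeq_tendsto_Gamma z).inv₀ (Gamma_ne_zero hz)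

/-- The growth rate of `poch z k` as `k → ∞`, up to the factor `(Gamma z)⁻¹`. -/
noncomputable def pochGrowth (z : ℂ) (k : ℕ) : ℂ := ((k + 1 : ℕ) : ℂ) ^ (z - 1) * k.factorial

lemma pochGrowth_ne_zero (z : ℂ) (k : ℕ) : pochGrowth z k ≠ 0 :=
  mul_ne_zero (by rw [Ne, cpow_eq_zero_iff]; simp [Nat.cast_add_one_ne_zero])
    (Nat.cast_ne_zero.mpr k.factorial_ne_zero)

lemma norm_pochGrowth (z : ℂ) (k : ℕ) :
    ‖pochGrowth z k‖ = ((k + 1 : ℕ) : ℝ) ^ (z.re - 1) * k.factorial := by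
  rw [pochGrowth, norm_mul, norm_natCast_cpow_of_pos k.succ_pos, norm_natCast]
  simp

lemma tendsto_poch_div_pochGrowth (z : ℂ) :
    Tendsto (fun k => poch z k / pochGrowth z k) atTop (𝓝 (Gamma z)⁻¹) := by
  have key := (((tendsto_inv_GammaSeq z).comp (tendsto_add_atTop_nat 1)).mul
    (tendsto_add_natCast_div_add_natCast 1 z)).mul
    (tendsto_add_natCast_div_add_natCast 1 (z + 1))
  rw [mul_one, mul_one] at key
  refine key.congr' ?_
  have hev : ∀ w : ℂ, ∀ᶠ k : ℕ in atTop, w + k ≠ 0 := fun w => by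
    filter_upwards [(tendsto_add_natCast_div_add_natCast w 1).eventually_ne one_ne_zero] with k hk h
    simp [h] at hk
  filter_upwards [hev z, hev (z + 1)] with k h1 h2
  have h3 : ((k + 1 : ℕ) : ℂ) ≠ 0 := Nat.cast_ne_zero.mpr k.succ_ne_zero
  have h4 : ((k + 1 : ℕ) : ℂ) ^ (z - 1) ≠ 0 := by
    rw [Ne, cpow_eq_zero_iff]
    exact fun h => h3 h.1
  have h5 : (k.factorial : ℂ) ≠ 0 := Nat.cast_ne_zero.mpr k.factorial_ne_zero
  have h6 : ((k + 1 : ℕ) : ℂ) ^ z = ((k + 1 : ℕ) : ℂ) ^ (z - 1) * ((k + 1 : ℕ) : ℂ) := by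
    conv_lhs => rw [← sub_add_cancel z 1, cpow_add _ _ h3, cpow_one]
  have h7 : GammaSeq z (k + 1) =
      ((k + 1 : ℕ) : ℂ) ^ z * (k + 1).factorial / poch z (k + 1 + 1) := rfl
  simp only [Function.comp_apply]
  rw [h7, h6, poch_succ, poch_succ, pochGrowth, Nat.factorial_succ]
  have h8 : z + ((k + 1 : ℕ) : ℂ) = z + 1 + k := by push_cast; ring
  rw [h8]
  generalize ((k + 1 : ℕ) : ℂ) ^ (z - 1) = x at *
  push_cast at h3 ⊢
  rw [add_comm (1 : ℂ)]
  field_simp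

lemma exists_norm_poch_le (z : ℂ) : ∃ C : ℝ, 0 < C ∧ ∀ k, ‖poch z k‖ ≤ C * ‖pochGrowth z k‖ := by
  obtain ⟨C, hC⟩ := (tendsto_poch_div_pochGrowth z).norm.bddAbove_range
  refine ⟨max C 1, by positivity, fun k => ?_⟩
  rw [← div_le_iff₀ (norm_pos_iff.mpr (pochGrowth_ne_zero z k)), ← norm_div]
  exact (hC ⟨k, rfl⟩).trans (le_max_left _ _)

lemma exists_norm_pochGrowth_le {z : ℂ} (hz : ∀ m : ℕ, z ≠ -(m : ℂ)) :
    ∃ C : ℝ, 0 < C ∧ ∀ k, ‖pochGrowth z k‖ ≤ C * ‖poch z k‖ := by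
  obtain ⟨C, hC⟩ := ((tendsto_poch_div_pochGrowth z).inv₀
    (inv_ne_zero (Gamma_ne_zero hz))).norm.bddAbove_range
  refine ⟨max C 1, by positivity, fun k => ?_⟩
  rw [← div_le_iff₀ (norm_pos_iff.mpr (poch_ne_zero hz k)), ← norm_div, ← inv_div]
  exact (hC ⟨k, rfl⟩).trans (le_max_left _ _)

lemma tendsto_poch_ratio {a b c d e f : ℂ} (h : a + b + c = d + e + f)
    (hd : ∀ m : ℕ, d ≠ -(m : ℂ)) (he : ∀ m : ℕ, e ≠ -(m : ℂ)) (hf : ∀ m : ℕ, f ≠ -(m : ℂ)) :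
    Tendsto (fun k => poch a k * poch b k * poch c k / (poch d k * poch e k * poch f k)) atTop
      (𝓝 (Gamma d * Gamma e * Gamma f / (Gamma a * Gamma b * Gamma c))) := by
  have key := (((tendsto_poch_div_pochGrowth a).mul (tendsto_poch_div_pochGrowth b)).mul
    (tendsto_poch_div_pochGrowth c)).div (((tendsto_poch_div_pochGrowth d).mul
    (tendsto_poch_div_pochGrowth e)).mul (tendsto_poch_div_pochGrowth f))
    (by simp [Gamma_ne_zero hd, Gamma_ne_zero he, Gamma_ne_zero hf])
  convert key using 1
  · ext k
    simp only [Pi.div_apply]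
    have hW : pochGrowth a k * pochGrowth b k * pochGrowth c k =
        pochGrowth d k * pochGrowth e k * pochGrowth f k := by
      have h0 : ((k + 1 : ℕ) : ℂ) ≠ 0 := Nat.cast_ne_zero.mpr k.succ_ne_zero
      have : ((k + 1 : ℕ) : ℂ) ^ (a - 1) * ((k + 1 : ℕ) : ℂ) ^ (b - 1) *
          ((k + 1 : ℕ) : ℂ) ^ (c - 1) = ((k + 1 : ℕ) : ℂ) ^ (d - 1) *
          ((k + 1 : ℕ) : ℂ) ^ (e - 1) * ((k + 1 : ℕ) : ℂ) ^ (f - 1) := by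
        simp only [← cpow_add _ _ h0]
        congr 1
        linear_combination h
      simp only [pochGrowth]
      linear_combination (k.factorial : ℂ) ^ 3 * this
    rw [div_mul_div_comm, div_mul_div_comm, div_mul_div_comm, div_mul_div_comm, hW,
      div_div_div_cancel_right₀]
    simp [pochGrowth_ne_zero]
  · congr 1
    simp only [div_eq_mul_inv, mul_inv, inv_inv]
    ring

lemma exists_norm_poch_ratio_le (a b c : ℂ) {d e f : ℂ}
    (hd : ∀ m : ℕ, d ≠ -(m : ℂ)) (he : ∀ m : ℕ, e ≠ -(m : ℂ)) (hf : ∀ m : ℕ, f ≠ -(m : ℂ)) :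
    ∃ C : ℝ, 0 < C ∧ ∀ k, ‖poch a k * poch b k * poch c k / (poch d k * poch e k * poch f k)‖ ≤
      C * ((k + 1 : ℕ) : ℝ) ^ (a + b + c - d - e - f).re := by
  obtain ⟨A, hA, hA'⟩ := exists_norm_poch_le a
  obtain ⟨B, hB, hB'⟩ := exists_norm_poch_le b
  obtain ⟨C, hC, hC'⟩ := exists_norm_poch_le c
  obtain ⟨D, hD, hD'⟩ := exists_norm_pochGrowth_le hd
  obtain ⟨E, hE, hE'⟩ := exists_norm_pochGrowth_le he
  obtain ⟨F, hF, hF'⟩ := exists_norm_pochGrowth_le hf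
  refine ⟨A * B * C * (D * E * F), by positivity, fun k => ?_⟩
  have hpos : (0 : ℝ) < ((k + 1 : ℕ) : ℝ) := by positivity
  have hW : ‖pochGrowth a k‖ * ‖pochGrowth b k‖ * ‖pochGrowth c k‖ =
      ((k + 1 : ℕ) : ℝ) ^ (a + b + c - d - e - f).re *
        (‖pochGrowth d k‖ * ‖pochGrowth e k‖ * ‖pochGrowth f k‖) := by
    have : ((k + 1 : ℕ) : ℝ) ^ (a.re - 1) * ((k + 1 : ℕ) : ℝ) ^ (b.re - 1) *
        ((k + 1 : ℕ) : ℝ) ^ (c.re - 1) = ((k + 1 : ℕ) : ℝ) ^ (a + b + c - d - e - f).re *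
        (((k + 1 : ℕ) : ℝ) ^ (d.re - 1) *
        ((k + 1 : ℕ) : ℝ) ^ (e.re - 1) * ((k + 1 : ℕ) : ℝ) ^ (f.re - 1)) := by
      simp only [← Real.rpow_add hpos]
      congr 1
      simp
      ring
    simp only [norm_pochGrowth]
    linear_combination (k.factorial : ℝ) ^ 3 * this
  have hden : 0 < ‖poch d k‖ * ‖poch e k‖ * ‖poch f k‖ := by
    have := poch_ne_zero hd k
    have := poch_ne_zero he k
    have := poch_ne_zero hf k
    positivity
  rw [norm_div, norm_mul, norm_mul, norm_mul, norm_mul, div_le_iff₀ hden]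
  calc ‖poch a k‖ * ‖poch b k‖ * ‖poch c k‖
      ≤ (A * ‖pochGrowth a k‖) * (B * ‖pochGrowth b k‖) * (C * ‖pochGrowth c k‖) := by
        gcongr
        exacts [hA' k, hB' k, hC' k]
    _ = A * B * C * ((k + 1 : ℕ) : ℝ) ^ (a + b + c - d - e - f).re *
        (‖pochGrowth d k‖ * ‖pochGrowth e k‖ * ‖pochGrowth f k‖) := by
        linear_combination A * B * C * hW
    _ ≤ A * B * C * ((k + 1 : ℕ) : ℝ) ^ (a + b + c - d - e - f).re *
        ((D * ‖poch d k‖) * (E * ‖poch e k‖) * (F * ‖poch f k‖)) := by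
        gcongr
        exacts [hD' k, hE' k, hF' k]
    _ = _ := by ring

lemma summable_natCast_succ_rpow {p : ℝ} (hp : p < -1) :
    Summable fun k : ℕ => ((k + 1 : ℕ) : ℝ) ^ p :=
  (summable_nat_add_iff 1).mpr (Real.summable_nat_rpow.mpr hp)

lemma summable_norm_poch_ratio {a b c d e : ℂ} (h : (a + b + c).re < (d + e).re)
    (hd : ∀ m : ℕ, d ≠ -(m : ℂ)) (he : ∀ m : ℕ, e ≠ -(m : ℂ)) :
    Summable fun k : ℕ => ‖poch a k * poch b k * poch c k /
      (poch d k * poch e k * (k.factorial : ℂ))‖ := by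
  obtain ⟨C, -, hC⟩ := exists_norm_poch_ratio_le a b c hd he one_ne_neg_natCast
  simp only [poch_one] at hC
  refine .of_nonneg_of_le (fun _ => norm_nonneg _) hC
    ((summable_natCast_succ_rpow ?_).mul_left C)
  simp only [add_re, sub_re, one_re] at h ⊢
  linarith

/-- The partial sums of the telescoping relation between the Gauss series at `e` and `e + 1`. -/
lemma sum_gauss_contiguous (a b : ℂ) {e : ℂ} (he : ∀ m : ℕ, e ≠ -(m : ℂ)) (N : ℕ) :
    ∑ k ∈ Finset.range (N + 1), (e * (e - a - b) *
        (poch a k * poch b k / (poch e k * (k.factorial : ℂ))) -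
      (e - a) * (e - b) * (poch a k * poch b k / (poch (e + 1) k * (k.factorial : ℂ)))) =
    -(poch a (N + 1) * poch b (N + 1) * poch 1 N / (poch (e + 1) N * poch 1 N * poch 1 N)) := by
  simp only [poch_one]
  induction N with
  | zero => simp [poch_succ, poch_zero]; ring
  | succ N ih =>
    have h0 : e ≠ 0 := by simpa using he 0
    have h1 : e + 1 + N ≠ 0 := by
      have := add_natCast_ne_zero he (N + 1)
      push_cast at this
      convert this using 1
      ring
    have h2 : poch (e + 1) N ≠ 0 := fun h =>
      poch_ne_zero he (N + 1) (by rw [poch_succ_left, h, mul_zero])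
    have h3 : (N.factorial : ℂ) ≠ 0 := Nat.cast_ne_zero.mpr N.factorial_ne_zero
    have h4 : (N + 1 : ℂ) ≠ 0 := Nat.cast_add_one_ne_zero N
    rw [Finset.sum_range_succ, ih, poch_succ_left e, poch_succ (e + 1), poch_succ a (N + 1),
      poch_succ b (N + 1), Nat.factorial_succ]
    push_cast
    field_simp
    ring

lemma summable_norm_gauss {a b e : ℂ} (hre : 0 < (e - a - b).re) (he : ∀ m : ℕ, e ≠ -(m : ℂ)) :
    Summable fun k : ℕ => ‖poch a k * poch b k / (poch e k * (k.factorial : ℂ))‖ := by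
  have h : (a + b + 1).re < (e + 1).re := by
    simp only [add_re, sub_re] at hre ⊢
    linarith
  refine (summable_norm_poch_ratio h he one_ne_neg_natCast).congr fun k => ?_
  rw [mul_right_comm (poch e k), mul_div_mul_right _ _ (poch_ne_zero one_ne_neg_natCast k)]

lemma tsum_gauss_contiguous {a b e : ℂ} (hre : 0 < (e - a - b).re)
    (he : ∀ m : ℕ, e ≠ -(m : ℂ)) :
    e * (e - a - b) * ∑' k : ℕ, poch a k * poch b k / (poch e k * (k.factorial : ℂ)) =
      (e - a) * (e - b) *
        ∑' k : ℕ, poch a k * poch b k / (poch (e + 1) k * (k.factorial : ℂ)) := by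
  have he' : ∀ m : ℕ, e + 1 ≠ -(m : ℂ) := by
    simpa using add_natCast_ne_neg_natCast he 1
  have hre' : 0 < (e + 1 - a - b).re := by
    simp only [add_re, sub_re, one_re] at hre ⊢
    linarith
  have hs := ((summable_norm_gauss hre he).of_norm.hasSum.mul_left (e * (e - a - b))).sub
    ((summable_norm_gauss hre' he').of_norm.hasSum.mul_left ((e - a) * (e - b)))
  have hlim := hs.tendsto_sum_nat.comp (tendsto_add_atTop_nat 1)
  rw [← sub_eq_zero]
  refine tendsto_nhds_unique hlim ?_
  obtain ⟨C, -, hC⟩ := exists_norm_poch_ratio_le (a + 1) (b + 1) 1 he' one_ne_neg_natCast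
    one_ne_neg_natCast
  have hp : Tendsto (fun k : ℕ => ((k + 1 : ℕ) : ℝ) ^
      (a + 1 + (b + 1) + 1 - (e + 1) - 1 - 1).re) atTop (𝓝 0) := by
    have := (tendsto_rpow_neg_atTop hre).comp
      (tendsto_natCast_atTop_atTop.comp (tendsto_add_atTop_nat 1))
    refine this.congr fun k => ?_
    simp only [Function.comp_apply]
    congr 1
    simp
    ring
  have h0 := (squeeze_zero_norm hC (by simpa using hp.const_mul C)).const_mul (-(a * b))
  rw [mul_zero] at h0
  refine h0.congr fun N => ?_
  simp only [Function.comp_apply]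
  rw [sum_gauss_contiguous a b he, poch_succ_left a, poch_succ_left b]
  ring

lemma tendsto_poch_add_natCast_div (u v : ℂ) (k : ℕ) :
    Tendsto (fun n : ℕ => poch (u + n) k / poch (v + n) k) atTop (𝓝 1) := by
  have := tendsto_finsetProd (Finset.range k)
    fun i _ => tendsto_add_natCast_div_add_natCast (u + i) (v + i)
  simp only [Finset.prod_const_one] at this
  refine this.congr fun n => ?_
  rw [poch, poch, ← Finset.prod_div_distrib]
  exact Finset.prod_congr rfl fun i _ => by ring_nf

lemma tendsto_inv_poch_add_natCast (v : ℂ) (k : ℕ) :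
    Tendsto (fun n : ℕ => (poch (v + n) k)⁻¹) atTop (𝓝 (0 ^ k)) := by
  have h : ∀ w : ℂ, Tendsto (fun n : ℕ => (w + n)⁻¹) atTop (𝓝 0) := fun w => by
    simpa using (tendsto_inv_atTop_nhds_zero_nat (𝕜 := ℂ)).mul
      (tendsto_add_natCast_div_add_natCast 0 w) |>.congr' (by
        filter_upwards [eventually_ne_atTop 0] with n hn
        have : (n : ℂ) ≠ 0 := Nat.cast_ne_zero.mpr hn
        rw [zero_add, div_eq_mul_inv, inv_mul_cancel_left₀ this])
  have := tendsto_finsetProd (Finset.range k) fun i _ => h (v + i)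
  simp only [Finset.prod_const, Finset.card_range] at this
  refine this.congr fun n => ?_
  rw [poch, ← Finset.prod_inv_distrib]
  exact Finset.prod_congr rfl fun i _ => by ring_nf

lemma norm_poch_le_norm_poch_add_natCast {e : ℂ} {n : ℕ} (hn : -(2 * e.re) ≤ n) (k : ℕ) :
    ‖poch e k‖ ≤ ‖poch (e + n) k‖ := by
  rw [poch, poch, norm_prod, norm_prod]
  refine Finset.prod_le_prod (fun _ _ => norm_nonneg _) fun i _ => ?_
  rw [← sq_le_sq₀ (norm_nonneg _) (norm_nonneg _), ← normSq_eq_norm_sq, ← normSq_eq_norm_sq,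
    normSq_apply, normSq_apply]
  simp only [add_re, add_im, natCast_re, natCast_im, add_zero]
  have h1 : (0 : ℝ) ≤ n := n.cast_nonneg
  have h2 : (0 : ℝ) ≤ i := i.cast_nonneg
  nlinarith [mul_nonneg h1 h2, mul_nonneg h1 (by linarith : 0 ≤ (n : ℝ) + 2 * e.re)]

lemma tendsto_tsum_gauss_add_natCast {a b e : ℂ} (hre : 0 < (e - a - b).re)
    (he : ∀ m : ℕ, e ≠ -(m : ℂ)) :
    Tendsto (fun n : ℕ => ∑' k : ℕ, poch a k * poch b k / (poch (e + n) k * (k.factorial : ℂ)))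
      atTop (𝓝 1) := by
  have h := tendsto_tsum_of_dominated_convergence
    (f := fun (n : ℕ) (k : ℕ) => poch a k * poch b k / (poch (e + n) k * (k.factorial : ℂ)))
    (g := fun k : ℕ => poch a k * poch b k / (k.factorial : ℂ) * 0 ^ k) (𝓕 := atTop)
    (summable_norm_gauss hre he) (fun k => ?_) ?_
  · rwa [tsum_eq_single 0 fun k hk => by simp [hk], poch_zero, poch_zero, Nat.factorial_zero,
      Nat.cast_one, pow_zero, mul_one, mul_one, div_one] at h
  · refine ((tendsto_inv_poch_add_natCast e k).const_mul _).congr fun n => ?_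
    rw [← div_eq_mul_inv, div_div, mul_comm (k.factorial : ℂ)]
  · filter_upwards [(tendsto_natCast_atTop_atTop (R := ℝ)).eventually_ge_atTop (-(2 * e.re))]
      with n hn k
    rw [norm_div, norm_div, norm_mul (poch e k), norm_mul (poch (e + n) k)]
    have := poch_ne_zero he k
    have : (k.factorial : ℂ) ≠ 0 := Nat.cast_ne_zero.mpr k.factorial_ne_zero
    gcongr
    exact norm_poch_le_norm_poch_add_natCast hn k

/-- Gauss's summation formula for `₂F₁(a, b; e; 1)`. -/
lemma tsum_gauss {a b e : ℂ} (hre : 0 < (e - a - b).re) (he : ∀ m : ℕ, e ≠ -(m : ℂ))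
    (heab : ∀ m : ℕ, e - a - b ≠ -(m : ℂ)) :
    ∑' k : ℕ, poch a k * poch b k / (poch e k * (k.factorial : ℂ)) =
      Gamma e * Gamma (e - a - b) / (Gamma (e - a) * Gamma (e - b)) := by
  have hiter : ∀ n : ℕ, ∑' k : ℕ, poch a k * poch b k / (poch e k * (k.factorial : ℂ)) =
      poch (e - a) n * poch (e - b) n * poch 1 n / (poch e n * poch (e - a - b) n * poch 1 n) *
        ∑' k : ℕ, poch a k * poch b k / (poch (e + n) k * (k.factorial : ℂ)) := by
    intro n
    rw [mul_div_mul_right _ _ (poch_ne_zero one_ne_neg_natCast n)]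
    induction n with
    | zero => simp [poch_zero]
    | succ n ih =>
      have hre' : 0 < (e + n - a - b).re := by
        have : (0 : ℝ) ≤ n := n.cast_nonneg
        simp only [add_re, sub_re, natCast_re] at hre ⊢
        linarith
      have hc := tsum_gauss_contiguous hre' (add_natCast_ne_neg_natCast he n)
      have h1 := add_natCast_ne_zero he n
      have h2 := add_natCast_ne_zero heab n
      have h3 := poch_ne_zero he n
      have h4 := poch_ne_zero heab n
      rw [ih, poch_succ, poch_succ, poch_succ, poch_succ, Nat.cast_succ, ← add_assoc,
        div_mul_eq_mul_div, div_mul_eq_mul_div,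
        div_eq_div_iff (mul_ne_zero h3 h4) (mul_ne_zero (mul_ne_zero h3 h1) (mul_ne_zero h4 h2))]
      linear_combination poch (e - a) n * poch (e - b) n * (poch e n * poch (e - a - b) n) * hc
  have hlim := (tendsto_poch_ratio (a := e - a) (b := e - b) (c := 1) (by ring) he heab
    one_ne_neg_natCast).mul (tendsto_tsum_gauss_add_natCast hre he)
  rw [mul_one, mul_div_mul_right _ _ (Gamma_ne_zero one_ne_neg_natCast)] at hlim
  exact tendsto_nhds_unique (tendsto_const_nhds.congr hiter) hlim

lemma exists_norm_poch_add_natCast_div_le {c s : ℂ} (hc : ∀ m : ℕ, c ≠ -(m : ℂ))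
    (hs : ∀ m : ℕ, s ≠ -(m : ℂ)) :
    ∃ C : ℝ, 0 < C ∧ ∀ n k : ℕ, ‖poch (c + n) k / poch (s + n) k‖ ≤
      C * ((k + 1 : ℕ) : ℝ) ^ max (c - s).re 0 := by
  obtain ⟨A, hA, hA'⟩ := exists_norm_poch_ratio_le c 1 1 hs one_ne_neg_natCast one_ne_neg_natCast
  obtain ⟨B, hB, hB'⟩ := exists_norm_poch_ratio_le s 1 1 hc one_ne_neg_natCast one_ne_neg_natCast
  have h1 := poch_ne_zero one_ne_neg_natCast
  simp only [mul_div_mul_right _ _ (h1 _)] at hA' hB'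
  refine ⟨A * B, by positivity, fun n k => ?_⟩
  have hn : (0 : ℝ) < ((n + 1 : ℕ) : ℝ) := by positivity
  have hnk : (0 : ℝ) < ((n + k + 1 : ℕ) : ℝ) := by positivity
  have hsplit : poch (c + n) k / poch (s + n) k =
      poch c (n + k) / poch s (n + k) * (poch s n / poch c n) := by
    have := poch_ne_zero hc n
    have := poch_ne_zero hs n
    rw [poch_add, poch_add]
    field_simp
  have hone : 1 ≤ ((n + k + 1 : ℕ) : ℝ) / ((n + 1 : ℕ) : ℝ) := by
    rw [one_le_div hn]
    exact_mod_cast by omega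
  have hle : ((n + k + 1 : ℕ) : ℝ) / ((n + 1 : ℕ) : ℝ) ≤ ((k + 1 : ℕ) : ℝ) := by
    rw [div_le_iff₀ hn]
    exact_mod_cast by nlinarith [Nat.zero_le (k * n)]
  have hre : (s + 1 + 1 - c - 1 - 1).re = -(c - s).re := by simp; ring
  have hre' : (c + 1 + 1 - s - 1 - 1).re = (c - s).re := by simp; ring
  calc ‖poch (c + n) k / poch (s + n) k‖
      ≤ (A * ((n + k + 1 : ℕ) : ℝ) ^ (c - s).re) * (B * ((n + 1 : ℕ) : ℝ) ^ (-(c - s).re)) := by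
        rw [hsplit, norm_mul]
        have h2 := hA' (n + k)
        have h3 := hB' n
        rw [hre'] at h2
        rw [hre] at h3
        gcongr
    _ = A * B * (((n + k + 1 : ℕ) : ℝ) / ((n + 1 : ℕ) : ℝ)) ^ (c - s).re := by
        rw [Real.div_rpow hnk.le hn.le, Real.rpow_neg hn.le]
        ring
    _ ≤ A * B * (((n + k + 1 : ℕ) : ℝ) / ((n + 1 : ℕ) : ℝ)) ^ max (c - s).re 0 := by
        gcongr
        exact le_max_left _ _
    _ ≤ _ := by gcongr

lemma tendsto_tsum_poch_add_natCast {a b c e s : ℂ} (hre : 0 < (e - a - b).re)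
    (h : (c - s).re < (e - a - b).re) (he : ∀ m : ℕ, e ≠ -(m : ℂ))
    (hc : ∀ m : ℕ, c ≠ -(m : ℂ)) (hs : ∀ m : ℕ, s ≠ -(m : ℂ)) :
    Tendsto (fun n : ℕ => ∑' k : ℕ, poch a k * poch b k * poch (c + n) k /
        (poch e k * poch (s + n) k * (k.factorial : ℂ)))
      atTop (𝓝 (∑' k : ℕ, poch a k * poch b k / (poch e k * (k.factorial : ℂ)))) := by
  obtain ⟨A, hA, hA'⟩ := exists_norm_poch_ratio_le a b 1 he one_ne_neg_natCast one_ne_neg_natCast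
  obtain ⟨B, hB, hB'⟩ := exists_norm_poch_add_natCast_div_le hc hs
  simp only [mul_div_mul_right _ _ (poch_ne_zero one_ne_neg_natCast _)] at hA'
  simp only [poch_one] at hA'
  have hsplit : ∀ n k : ℕ, poch a k * poch b k * poch (c + n) k /
      (poch e k * poch (s + n) k * (k.factorial : ℂ)) =
      poch a k * poch b k / (poch e k * (k.factorial : ℂ)) *
        (poch (c + n) k / poch (s + n) k) := fun n k => by
    rw [div_mul_div_comm, mul_right_comm (poch e k)]
  simp only [hsplit]
  have hexp : (a + b + 1 - e - 1 - 1).re + max (c - s).re 0 < -1 := by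
    have := max_lt h hre
    simp only [add_re, sub_re, one_re] at this ⊢
    linarith
  refine tendsto_tsum_of_dominated_convergence
    ((summable_natCast_succ_rpow hexp).mul_left (A * B)) (fun k => ?_) (.of_forall fun n k => ?_)
  · simpa using (tendsto_poch_add_natCast_div c s k).const_mul
      (poch a k * poch b k / (poch e k * (k.factorial : ℂ)))
  · rw [norm_mul, Real.rpow_add (by positivity), mul_mul_mul_comm]
    gcongr
    exacts [hA' k, hB' n k]

/-- The first of the two terms of the nonterminating Saalschütz formula. -/
noncomputable def saalschutzTerm (a b c e : ℂ) : ℂ :=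
  Gamma (a + c - e + 1) * Gamma (b + c - e + 1) /
      (Gamma (c - e + 1) * Gamma (a + b + c - e + 1)) *
    ∑' k : ℕ, poch a k * poch b k * poch c k /
      (poch e k * poch (a + b + c - e + 1) k * (k.factorial : ℂ))

lemma tendsto_saalschutzTerm_add_natCast {a b c e : ℂ} (hre : 0 < (e - a - b).re)
    (he : ∀ m : ℕ, e ≠ -(m : ℂ)) (heab : ∀ m : ℕ, e - a - b ≠ -(m : ℂ))
    (h1 : ∀ m : ℕ, a + c - e + 1 ≠ -(m : ℂ)) (h2 : ∀ m : ℕ, b + c - e + 1 ≠ -(m : ℂ))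
    (h3 : ∀ m : ℕ, a + b + c - e + 1 ≠ -(m : ℂ)) (h4 : ∀ m : ℕ, c ≠ -(m : ℂ))
    (h5 : ∀ m : ℕ, c - e + 1 ≠ -(m : ℂ)) :
    Tendsto (fun n : ℕ => saalschutzTerm a b (c + n) e) atTop
      (𝓝 (Gamma e * Gamma (e - a - b) / (Gamma (e - a) * Gamma (e - b)))) := by
  have hcs : (c - (a + b + c - e + 1)).re < (e - a - b).re := by
    simp only [add_re, sub_re, one_re]
    linarith
  have hpre := (tendsto_poch_ratio (a := a + c - e + 1) (b := b + c - e + 1) (c := 1)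
    (by ring) h5 h3 one_ne_neg_natCast).const_mul (Gamma (a + c - e + 1) *
      Gamma (b + c - e + 1) / (Gamma (c - e + 1) * Gamma (a + b + c - e + 1)))
  have hlim := hpre.mul (tendsto_tsum_poch_add_natCast hre hcs he h4 h3)
  have g1 := Gamma_ne_zero h1
  have g2 := Gamma_ne_zero h2
  have g3 := Gamma_ne_zero h3
  have g5 := Gamma_ne_zero h5
  rw [tsum_gauss hre he heab, mul_div_mul_right _ _ (Gamma_ne_zero one_ne_neg_natCast),
    div_mul_div_cancel₀ (mul_ne_zero g5 g3), div_self (mul_ne_zero g1 g2), one_mul] at hlim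
  refine hlim.congr fun n => ?_
  rw [saalschutzTerm, show a + (c + n) - e + 1 = a + c - e + 1 + n by ring,
    show b + (c + n) - e + 1 = b + c - e + 1 + n by ring,
    show a + b + (c + n) - e + 1 = a + b + c - e + 1 + n by ring,
    show c + n - e + 1 = c - e + 1 + n by ring, Gamma_add_natCast h1, Gamma_add_natCast h2,
    Gamma_add_natCast h3, Gamma_add_natCast h5,
    mul_div_mul_right _ _ (poch_ne_zero one_ne_neg_natCast n), div_mul_div_comm]
  congr 2 <;> ring

/-- The partial sums of the telescoping relation between the Saalschützian series at `c`
and `c + 1`. -/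
lemma sum_saalschutz_contiguous {a b c e s : ℂ} (hs' : s = a + b + c - e + 1)
    (he : ∀ m : ℕ, e ≠ -(m : ℂ)) (hs : ∀ m : ℕ, s ≠ -(m : ℂ)) (N : ℕ) :
    ∑ k ∈ Finset.range (N + 1), ((a + c - e + 1) * (b + c - e + 1) / s *
        (poch a k * poch b k * poch (c + 1) k / (poch e k * poch (s + 1) k * (k.factorial : ℂ))) -
      (c - e + 1) *
        (poch a k * poch b k * poch c k / (poch e k * poch s k * (k.factorial : ℂ)))) =
    a * b / s * (poch (a + 1) N * poch (b + 1) N * poch (c + 1) N /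
      (poch e N * poch (s + 1) N * poch 1 N)) := by
  have h0 : s ≠ 0 := by simpa using hs 0
  have hs1 : ∀ m : ℕ, s + 1 ≠ -(m : ℂ) := by simpa using add_natCast_ne_neg_natCast hs 1
  simp only [poch_one]
  induction N with
  | zero =>
    simp [poch_zero]
    field_simp
    rw [hs']
    ring
  | succ N ih =>
    have h1 := add_natCast_ne_zero hs1 N
    have h2 := poch_ne_zero hs1 N
    have h3 : (N.factorial : ℂ) ≠ 0 := Nat.cast_ne_zero.mpr N.factorial_ne_zero
    have h4 : (N + 1 : ℂ) ≠ 0 := Nat.cast_add_one_ne_zero N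
    have h5 := poch_ne_zero he N
    have h6 := add_natCast_ne_zero he N
    rw [Finset.sum_range_succ, ih, poch_succ_left a, poch_succ_left b, poch_succ_left c,
      poch_succ_left s, poch_succ (a + 1), poch_succ (b + 1), poch_succ (c + 1),
      poch_succ e, poch_succ (s + 1), Nat.factorial_succ]
    push_cast
    field_simp
    rw [hs']
    ring

lemma saalschutzTerm_add_one_sub {a b c e : ℂ}
    (he : ∀ m : ℕ, e ≠ -(m : ℂ))
    (h1 : ∀ m : ℕ, a + c - e + 1 ≠ -(m : ℂ)) (h2 : ∀ m : ℕ, b + c - e + 1 ≠ -(m : ℂ))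
    (h3 : ∀ m : ℕ, a + b + c - e + 1 ≠ -(m : ℂ)) :
    saalschutzTerm a b (c + 1) e - saalschutzTerm a b c e =
      Gamma e * Gamma (a + c - e + 1) * Gamma (b + c - e + 1) /
        (Gamma a * Gamma b * Gamma (c + 1) * Gamma (c - e + 2)) := by
  have hs1 : ∀ m : ℕ, a + b + c - e + 1 + 1 ≠ -(m : ℂ) := by
    simpa using add_natCast_ne_neg_natCast h3 1
  have n1 : a + c - e + 1 ≠ 0 := by simpa using h1 0
  have n2 : b + c - e + 1 ≠ 0 := by simpa using h2 0
  have n3 : a + b + c - e + 1 ≠ 0 := by simpa using h3 0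
  rw [saalschutzTerm, saalschutzTerm, show a + (c + 1) - e + 1 = a + c - e + 1 + 1 by ring,
    show b + (c + 1) - e + 1 = b + c - e + 1 + 1 by ring,
    show a + b + (c + 1) - e + 1 = a + b + c - e + 1 + 1 by ring,
    show c + 1 - e + 1 = c - e + 1 + 1 by ring, show c - e + 2 = c - e + 1 + 1 by ring,
    Gamma_add_one _ n1, Gamma_add_one _ n2, Gamma_add_one _ n3]
  have hsum1 : Summable fun k : ℕ => ‖poch a k * poch b k * poch (c + 1) k /
      (poch e k * poch (a + b + c - e + 1 + 1) k * (k.factorial : ℂ))‖ :=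
    summable_norm_poch_ratio (by simp; linarith) he hs1
  have hsum0 : Summable fun k : ℕ => ‖poch a k * poch b k * poch c k /
      (poch e k * poch (a + b + c - e + 1) k * (k.factorial : ℂ))‖ :=
    summable_norm_poch_ratio (by simp; linarith) he h3
  have hlim := ((hsum1.of_norm.hasSum.mul_left ((a + c - e + 1) * (b + c - e + 1) /
    (a + b + c - e + 1))).sub (hsum0.of_norm.hasSum.mul_left (c - e + 1))).tendsto_sum_nat.comp
      (tendsto_add_atTop_nat 1)
  simp only [Function.comp_def, sum_saalschutz_contiguous rfl he h3] at hlim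
  have key := tendsto_nhds_unique hlim ((tendsto_poch_ratio (by ring) he hs1
    one_ne_neg_natCast).const_mul (a * b / (a + b + c - e + 1)))
  have ga := one_div_Gamma_eq_self_mul_one_div_Gamma_add_one a
  have gb := one_div_Gamma_eq_self_mul_one_div_Gamma_add_one b
  have gd := one_div_Gamma_eq_self_mul_one_div_Gamma_add_one (c - e + 1)
  have g3 := Gamma_ne_zero h3
  rw [Gamma_add_one _ n3, Gamma_one] at key
  generalize (∑' k : ℕ, poch a k * poch b k * poch (c + 1) k /
      (poch e k * poch (a + b + c - e + 1 + 1) k * (k.factorial : ℂ))) = S1 at *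
  generalize (∑' k : ℕ, poch a k * poch b k * poch c k /
      (poch e k * poch (a + b + c - e + 1) k * (k.factorial : ℂ))) = S0 at *
  generalize a + b + c - e + 1 = s at *
  simp only [div_eq_mul_inv, mul_inv] at ga gb gd key ⊢
  rw [ga, gb, gd]
  generalize (Gamma (c - e + 1 + 1))⁻¹ = x at *
  have hg : (Gamma s)⁻¹ * Gamma s = 1 := inv_mul_cancel₀ g3
  have hs : s⁻¹ * s = 1 := inv_mul_cancel₀ n3
  linear_combination Gamma (a + c - e + 1) * Gamma (b + c - e + 1) * x * (Gamma s)⁻¹ * key +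
    Gamma (a + c - e + 1) * Gamma (b + c - e + 1) * x * a * b * Gamma e * (Gamma (a + 1))⁻¹ *
      (Gamma (b + 1))⁻¹ * (Gamma (c + 1))⁻¹ * (s⁻¹ * s * hg + hs)

/-- Nonterminating analogue of Saalschütz' summation formula. -/
theorem nonterminating_saalschutz (a b c e : ℂ) (hre : 0 < (e - a - b).re)
    (he : ∀ m : ℕ, e ≠ -(m : ℂ))
    (heab : ∀ m : ℕ, e - a - b ≠ -(m : ℂ))
    (h1 : ∀ m : ℕ, a + c - e + 1 ≠ -(m : ℂ))
    (h2 : ∀ m : ℕ, b + c - e + 1 ≠ -(m : ℂ))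
    (h3 : ∀ m : ℕ, a + b + c - e + 1 ≠ -(m : ℂ))
    (h4 : ∀ m : ℕ, c + 1 ≠ -(m : ℂ))
    (h5 : ∀ m : ℕ, c - e + 2 ≠ -(m : ℂ)) :
    (Summable fun k : ℕ =>
      ‖poch a k * poch b k * poch c k /
        (poch e k * poch (a + b + c - e + 1) k * (Nat.factorial k : ℂ))‖) ∧
    (Summable fun k : ℕ =>
      ‖poch (a + c - e + 1) k * poch (b + c - e + 1) k * poch 1 k /
        (poch (c + 1) k * poch (c - e + 2) k * (Nat.factorial k : ℂ))‖) ∧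
    Complex.Gamma (a + c - e + 1) * Complex.Gamma (b + c - e + 1) /
        (Complex.Gamma (c - e + 1) * Complex.Gamma (a + b + c - e + 1)) *
      (∑' k : ℕ, poch a k * poch b k * poch c k /
        (poch e k * poch (a + b + c - e + 1) k * (Nat.factorial k : ℂ))) +
    Complex.Gamma e * Complex.Gamma (a + c - e + 1) * Complex.Gamma (b + c - e + 1) /
        (Complex.Gamma a * Complex.Gamma b * Complex.Gamma (c + 1) *
          Complex.Gamma (c - e + 2)) *
      (∑' k : ℕ, poch (a + c - e + 1) k * poch (b + c - e + 1) k * poch 1 k /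
        (poch (c + 1) k * poch (c - e + 2) k * (Nat.factorial k : ℂ))) =
    Complex.Gamma e * Complex.Gamma (e - a - b) /
      (Complex.Gamma (e - a) * Complex.Gamma (e - b)) := by
  have hS1 : Summable fun k : ℕ => ‖poch a k * poch b k * poch c k /
      (poch e k * poch (a + b + c - e + 1) k * (Nat.factorial k : ℂ))‖ :=
    summable_norm_poch_ratio (by simp; linarith) he h3
  have hS2 : Summable fun k : ℕ => ‖poch (a + c - e + 1) k * poch (b + c - e + 1) k * poch 1 k /
      (poch (c + 1) k * poch (c - e + 2) k * (Nat.factorial k : ℂ))‖ := by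
    refine summable_norm_poch_ratio ?_ h4 h5
    simp only [add_re, sub_re, one_re, re_ofNat] at hre ⊢
    linarith
  refine ⟨hS1, hS2, ?_⟩
  have hdiff : ∀ k : ℕ, Gamma e * Gamma (a + c - e + 1) * Gamma (b + c - e + 1) /
        (Gamma a * Gamma b * Gamma (c + 1) * Gamma (c - e + 2)) *
      (poch (a + c - e + 1) k * poch (b + c - e + 1) k * poch 1 k /
        (poch (c + 1) k * poch (c - e + 2) k * (Nat.factorial k : ℂ))) =
      saalschutzTerm a b (c + (k + 1 : ℕ)) e - saalschutzTerm a b (c + k) e := by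
    intro k
    have e1 : a + (c + k) - e + 1 = a + c - e + 1 + k := by ring
    have e2 : b + (c + k) - e + 1 = b + c - e + 1 + k := by ring
    have e3 : a + b + (c + k) - e + 1 = a + b + c - e + 1 + k := by ring
    rw [Nat.cast_succ, ← add_assoc, saalschutzTerm_add_one_sub he
      (by rw [e1]; exact add_natCast_ne_neg_natCast h1 k)
      (by rw [e2]; exact add_natCast_ne_neg_natCast h2 k)
      (by rw [e3]; exact add_natCast_ne_neg_natCast h3 k), e1, e2,
      show c + k + 1 = c + 1 + k by ring, show c + k - e + 2 = c - e + 2 + k by ring,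
      Gamma_add_natCast h1, Gamma_add_natCast h2, Gamma_add_natCast h4, Gamma_add_natCast h5,
      ← poch_one, mul_div_mul_right _ _ (poch_ne_zero one_ne_neg_natCast k), div_mul_div_comm]
    congr 1 <;> ring
  have hsum := (hS2.of_norm.hasSum.mul_left (Gamma e * Gamma (a + c - e + 1) *
    Gamma (b + c - e + 1) / (Gamma a * Gamma b * Gamma (c + 1) *
      Gamma (c - e + 2)))).tendsto_sum_nat
  simp only [hdiff, Finset.sum_range_sub fun k : ℕ => saalschutzTerm a b (c + k) e] at hsum
  have hshift : ∀ {z w : ℂ}, w = z + 1 → (∀ m : ℕ, z ≠ -(m : ℂ)) → ∀ m : ℕ, w ≠ -(m : ℂ) := by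
    rintro z w rfl hz
    simpa using add_natCast_ne_neg_natCast hz 1
  have hlim := tendsto_saalschutzTerm_add_natCast (c := c + 1) hre he heab
    (hshift (by ring) h1) (hshift (by ring) h2) (hshift (by ring) h3) h4
    (by rwa [show c + 1 - e + 1 = c - e + 2 by ring])
  have hlim' : Tendsto (fun n : ℕ => saalschutzTerm a b (c + n) e) atTop
      (𝓝 (Gamma e * Gamma (e - a - b) / (Gamma (e - a) * Gamma (e - b)))) := by
    refine (tendsto_add_atTop_iff_nat 1).mp (hlim.congr fun n => ?_)
    rw [Nat.cast_succ, add_right_comm, add_assoc]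
  have key := tendsto_nhds_unique hsum (hlim'.sub_const _)
  rw [Nat.cast_zero, add_zero, saalschutzTerm] at key
  linear_combination key
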